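/- Let M_P be a holomorphically nondegenerate model hypersurface. If Y = f₁∂/∂z₁ + f₂∂/∂z₂ and Y' = f₁'∂/∂z₁ + f₂'∂/∂z₂ are both generalized rotations of M_P, then Y and Y' are linearly dependent over ℝ: there exist real numbers a, b, not both zero, with a·f₁ + b·f₁' = 0 and a·f₂ + b·f₂' = 0. In particular, the real dimension of the space g_c of generalized rotations of M_P is at most one. -/

import Mathlib

open MvPolynomial Complex

noncomputable section

/-- Polynomials in the two holomorphic variables `z₁, z₂`. -/
abbrev P2 := MvPolynomial (Fin 2) ℂ

/-- Polynomials in `z₁, z₂` (indexed by `Sum.inl`) and the antiholomorphic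
variables `z̄₁, z̄₂` (indexed by `Sum.inr`). -/
abbrev P4 := MvPolynomial (Fin 2 ⊕ Fin 2) ℂ

/-- Substitution `(z, z̄)`. -/
def mix (z : Fin 2 → ℂ) : Fin 2 ⊕ Fin 2 → ℂ :=
  Sum.elim z (fun j => (starRingEnd ℂ) (z j))

namespace MvPolynomial

variable {σ τ R M : Type*} [CommSemiring R]

theorem IsWeightedHomogeneous.rename [AddCommMonoid M] {w : τ → M} {g : σ → τ}
    {p : MvPolynomial σ R} {n : M} (hp : IsWeightedHomogeneous (w ∘ g) p n) :
    IsWeightedHomogeneous w (rename g p) n := by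
  intro d hd
  obtain ⟨u, rfl, hu⟩ := coeff_rename_ne_zero g p d hd
  rw [← hp hu]
  simp [Finsupp.weight, Finsupp.linearCombination_mapDomain]

theorem isWeightedHomogeneous_zero_weight [AddCommMonoid M] (p : MvPolynomial σ R) :
    IsWeightedHomogeneous (0 : σ → M) p 0 := by
  intro d _
  simp [Finsupp.weight]

/-- A first-order operator `F * ∂ᵢ` with weighted homogeneous coefficient shifts the
weighted homogeneous components. -/
theorem weightedHomogeneousComponent_mul_pderiv [AddCommGroup M] {w : σ → M} {i : σ}
    {F : MvPolynomial σ R} {δ : M} (hF : IsWeightedHomogeneous w F (w i + δ)) (k : M)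
    (p : MvPolynomial σ R) :
    weightedHomogeneousComponent w (k + δ) (F * pderiv i p) =
      F * pderiv i (weightedHomogeneousComponent w k p) := by
  classical
  induction p using MvPolynomial.induction_on' with
  | add p q hp hq => simp only [map_add, mul_add, hp, hq]
  | monomial d r =>
    have hd := isWeightedHomogeneous_monomial w d r rfl
    have hFd : IsWeightedHomogeneous w (F * pderiv i (monomial d r))
        (Finsupp.weight w d + δ) := by
      have h := hF.mul (hd.pderiv (i := i) (n' := Finsupp.weight w d - w i) (by abel))
      convert h using 1
      abel
    by_cases hk : Finsupp.weight w d = k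
    · subst hk
      rw [hFd.weightedHomogeneousComponent_same, hd.weightedHomogeneousComponent_same]
    · rw [hFd.weightedHomogeneousComponent_ne _ (by simpa using Ne.symm hk),
        hd.weightedHomogeneousComponent_ne _ (Ne.symm hk)]
      simp

end MvPolynomial

/-- The polynomial whose value at `(z, z̄)` is the conjugate of that of the given one. -/
def conjSwap : P4 →+* P4 :=
  (rename Sum.swap : P4 →ₐ[ℂ] P4).toRingHom.comp (map (starRingEnd ℂ))

theorem eval_mix_conjSwap (z : Fin 2 → ℂ) (p : P4) :
    eval (mix z) (conjSwap p) = (starRingEnd ℂ) (eval (mix z) p) := by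
  induction p using MvPolynomial.induction_on with
  | C a => simp [conjSwap]
  | add p q hp hq => simp [hp, hq]
  | mul_X p i hp =>
    rw [map_mul, map_mul, hp, map_mul, map_mul]
    congr 1
    cases i <;> simp [conjSwap, mix]

theorem conjSwap_rename_inl (p : P2) :
    conjSwap (rename Sum.inl p) = rename Sum.inr (map (starRingEnd ℂ) p) := by
  simp only [conjSwap, RingHom.comp_apply, map_rename]
  change rename Sum.swap (rename Sum.inl _) = _
  rw [rename_rename]
  rfl

theorem conjSwap_pderiv_inl (j : Fin 2) (p : P4) :
    conjSwap (pderiv (Sum.inl j) p) = pderiv (Sum.inr j) (conjSwap p) := by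
  simp only [conjSwap, RingHom.comp_apply, ← pderiv_map]
  change rename Sum.swap _ = pderiv (Sum.swap (Sum.inl j)) (rename Sum.swap _)
  rw [pderiv_rename Sum.swap_leftInverse.injective]

/-- A polynomial in `z, z̄` vanishing at all `(z, z̄)` is zero. -/
theorem eq_zero_of_eval_mix {p : P4} (h : ∀ z, eval (mix z) p = 0) : p = 0 := by
  let S : Fin 2 ⊕ Fin 2 → P4 := Sum.elim (fun j => X (Sum.inl j) + C I * X (Sum.inr j))
    (fun j => X (Sum.inl j) - C I * X (Sum.inr j))
  have key (x : Fin 2 ⊕ Fin 2 → ℂ) : eval x (bind₁ S p) = eval (fun i => eval x (S i)) p :=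
    eval₂Hom_bind₁ (RingHom.id ℂ) x S p
  have hS : bind₁ S p = 0 := by
    refine funext_set (fun _ => Set.range ((↑) : ℝ → ℂ))
      (fun _ => Set.infinite_range_of_injective ofReal_injective) fun x hx => ?_
    choose y hy using fun i => hx i (Set.mem_univ i)
    rw [map_zero, key, ← h (fun j => x (Sum.inl j) + I * x (Sum.inr j))]
    congr 2
    ext i
    rcases i with j | j <;> simp [S, mix, ← hy, sub_eq_add_neg]
  refine funext fun u => ?_
  have hu := key (Sum.elim (fun j => (u (Sum.inl j) + u (Sum.inr j)) / 2)
    (fun j => (u (Sum.inl j) - u (Sum.inr j)) / (2 * I)))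
  rw [hS, map_zero] at hu
  rw [map_zero, hu]
  congr 2
  ext i
  rcases i with j | j <;> simp [S] <;> field_simp <;> ring

/-- A polynomial in `z, z̄` with vanishing real part is opposite to its conjugate. -/
theorem add_conjSwap_eq_zero {p : P4} (h : ∀ z, (eval (mix z) p).re = 0) :
    p + conjSwap p = 0 :=
  eq_zero_of_eval_mix fun z => by
    rw [map_add, eval_mix_conjSwap, add_conj, h, mul_zero, ofReal_zero]

theorem conjSwap_eq_self {p : P4} (h : ∀ z, (eval (mix z) p).im = 0) : conjSwap p = p :=
  sub_eq_zero.1 <| eq_zero_of_eval_mix fun z => by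
    rw [map_sub, eval_mix_conjSwap, conj_eq_iff_im.2 (h z), sub_self]

/-- The action `f₀ ∂P/∂z₀ + f₁ ∂P/∂z₁` of a holomorphic vector field. -/
def act (f : Fin 2 → P2) (P : P4) : P4 :=
  rename Sum.inl (f 0) * pderiv (Sum.inl 0) P + rename Sum.inl (f 1) * pderiv (Sum.inl 1) P

theorem act_add_conjSwap {f : Fin 2 → P2} {P : P4}
    (htan : ∀ z : Fin 2 → ℂ,
      (eval z (f 0) * eval (mix z) (pderiv (Sum.inl 0) P) +
       eval z (f 1) * eval (mix z) (pderiv (Sum.inl 1) P)).re = 0) :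
    act f P + conjSwap (act f P) = 0 := by
  refine add_conjSwap_eq_zero fun z => ?_
  have h : ∀ p : P2, eval (mix z) (rename Sum.inl p) = eval z p := fun p => by
    rw [eval_rename]
    rfl
  simpa [act, h] using htan z

/-- A generalized rotation annihilates the component of `P` of top degree in `z`. -/
theorem act_top_component_eq_zero {μ : Fin 2 → ℚ} {f : Fin 2 → P2} {P : P4} {δ K : ℚ}
    (hδ : 0 < δ) (hfhom : ∀ j, IsWeightedHomogeneous μ (f j) (μ j + δ))
    (hP : conjSwap P = P) (h : act f P + conjSwap (act f P) = 0)
    (hK : ∀ m ∈ P.support, Finsupp.weight (Sum.elim μ 0) m ≤ K) :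
    act f (weightedHomogeneousComponent (Sum.elim μ 0) K P) = 0 := by
  have hF (j : Fin 2) : IsWeightedHomogeneous (Sum.elim μ (0 : Fin 2 → ℚ))
      (rename Sum.inl (f j)) (Sum.elim μ (0 : Fin 2 → ℚ) (Sum.inl j) + δ) :=
    IsWeightedHomogeneous.rename (w := Sum.elim μ (0 : Fin 2 → ℚ)) (g := Sum.inl) (hfhom j)
  have hG (j : Fin 2) : IsWeightedHomogeneous (Sum.elim μ (0 : Fin 2 → ℚ))
      (rename Sum.inr (map (starRingEnd ℂ) (f j)))
      (Sum.elim μ (0 : Fin 2 → ℚ) (Sum.inr j) + 0) := by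
    simpa using IsWeightedHomogeneous.rename (w := Sum.elim μ (0 : Fin 2 → ℚ))
      (g := Sum.inr) (isWeightedHomogeneous_zero_weight (map (starRingEnd ℂ) (f j)))
  have hzero : weightedHomogeneousComponent (Sum.elim μ 0) (K + δ) P = 0 :=
    weightedHomogeneousComponent_eq_zero' _ _ fun m hm => ((hK m hm).trans_lt (by simpa)).ne
  have h' := congrArg (weightedHomogeneousComponent (Sum.elim μ 0) (K + δ)) h
  have hconj : weightedHomogeneousComponent (Sum.elim μ (0 : Fin 2 → ℚ)) (K + δ)
      (conjSwap (act f P)) = 0 := by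
    have hcomp (j : Fin 2) := weightedHomogeneousComponent_mul_pderiv (hG j) (K + δ) P
    simp only [hzero, map_zero, mul_zero, add_zero (K + δ)] at hcomp
    simp only [act, map_add, map_mul, conjSwap_rename_inl, conjSwap_pderiv_inl, hP, hcomp,
      add_zero]
  rw [map_add, hconj, add_zero, map_zero] at h'
  simpa only [act, map_add, weightedHomogeneousComponent_mul_pderiv (hF _)] using h'

theorem exists_pderiv_inl_ne_zero {Q : P4} {m : Fin 2 ⊕ Fin 2 →₀ ℕ} (hm : m ∈ Q.support)
    (h : ∃ i, m (Sum.inl i) ≠ 0) : ∃ i, pderiv (Sum.inl i) Q ≠ 0 := by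
  obtain ⟨i, hi⟩ := h
  refine ⟨i, fun h0 => ?_⟩
  have hc := congrArg (coeff (m - Finsupp.single (Sum.inl i) 1)) h0
  rw [coeff_pderiv, tsub_add_cancel_of_le
    (Finsupp.single_le_iff.2 (Nat.one_le_iff_ne_zero.2 hi)), coeff_zero] at hc
  refine mul_ne_zero (mem_support_iff.1 hm) ?_ hc
  exact Nat.cast_add_one_ne_zero _

/-- Two vector fields annihilating a common polynomial that is not constant in `z` are
proportional. -/
theorem mul_comm_of_act_eq_zero {f f' : Fin 2 → P2} {Q : P4}
    (hQ : ∃ i, pderiv (Sum.inl i) Q ≠ 0) (h : act f Q = 0) (h' : act f' Q = 0) :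
    f 0 * f' 1 = f 1 * f' 0 := by
  refine rename_injective (R := ℂ) (Sum.inl : Fin 2 → Fin 2 ⊕ Fin 2) Sum.inl_injective ?_
  obtain ⟨i, hi⟩ := hQ
  refine mul_right_cancel₀ hi ?_
  unfold act at h h'
  simp only [map_mul]
  fin_cases i <;> simp only [Fin.zero_eta, Fin.mk_one]
  · linear_combination rename Sum.inl (f' 1) * h - rename Sum.inl (f 1) * h'
  · linear_combination rename Sum.inl (f 0) * h' - rename Sum.inl (f' 0) * h

/-- If `p(z) q̄(w̄) = p̄(w̄) q(z)` with `p ≠ 0`, then `q` is a real multiple of `p`. -/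
theorem exists_real_eq_C_mul {p q : P2} (hp : p ≠ 0)
    (h : rename Sum.inl p * conjSwap (rename Sum.inl q) =
      conjSwap (rename Sum.inl p) * rename Sum.inl q) :
    ∃ c : ℝ, q = C (c : ℂ) * p := by
  have hz (z w : Fin 2 → ℂ) : eval z p * (starRingEnd ℂ) (eval w q) =
      (starRingEnd ℂ) (eval w p) * eval z q := by
    have := congrArg (eval (Sum.elim z fun j => (starRingEnd ℂ) (w j))) h
    have hc (r : P2) : eval (fun j => (starRingEnd ℂ) (w j)) (map (starRingEnd ℂ) r) =
        (starRingEnd ℂ) (eval w r) := by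
      rw [eval_map]
      exact (eval₂_comp_left (starRingEnd ℂ) (RingHom.id ℂ) w r).symm
    simpa [conjSwap_rename_inl, eval_rename, hc, Sum.elim_comp_inl, Sum.elim_comp_inr] using this
  obtain ⟨w, hw⟩ : ∃ w, eval w p ≠ 0 := by
    by_contra! h0
    exact hp (funext fun w => by simpa using h0 w)
  have hw' : (starRingEnd ℂ) (eval w p) ≠ 0 := by simpa using hw
  have hreal : (starRingEnd ℂ) (eval w q / eval w p) = eval w q / eval w p := by
    rw [map_div₀, div_eq_div_iff hw' hw]
    linear_combination hz w w
  obtain ⟨c, hc⟩ := conj_eq_iff_real.1 hreal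
  refine ⟨c, funext fun z => ?_⟩
  rw [map_mul, eval_C, ← hc, ← hreal, map_div₀]
  field_simp
  linear_combination - hz z w

/-- any two generalized rotations of a holomorphically nondegenerate
model hypersurface `M_P` are linearly dependent over `ℝ`; in particular
`dim_ℝ g_c ≤ 1`. -/
theorem stmt7 (μ : Fin 2 → ℚ) (hμ0 : 0 < μ 1) (hμ12 : μ 1 ≤ μ 0) (hμ1 : μ 0 ≤ 1 / 2)
    (P : P4)
    (hreal : ∀ z : Fin 2 → ℂ, (eval (mix z) P).im = 0)
    (hPhom : IsWeightedHomogeneous (Sum.elim μ μ) P 1)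
    (hplh : ∀ m ∈ P.support, (∃ i, m (Sum.inl i) ≠ 0) ∧ (∃ i, m (Sum.inr i) ≠ 0))
    -- `M_P` is holomorphically nondegenerate:
    (hnd : ∀ g : Fin 2 → P2,
      rename Sum.inl (g 0) * pderiv (Sum.inl 0) P +
        rename Sum.inl (g 1) * pderiv (Sum.inl 1) P = 0 → g = 0)
    -- `Y = f₁ ∂/∂z₁ + f₂ ∂/∂z₂` is a generalized rotation of `M_P`:
    (f : Fin 2 → P2) (hf : f ≠ 0) (δ : ℚ) (hδ : 0 < δ)
    (hfhom : ∀ j, IsWeightedHomogeneous μ (f j) (μ j + δ))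
    (htan : ∀ z : Fin 2 → ℂ,
      (eval z (f 0) * eval (mix z) (pderiv (Sum.inl 0) P) +
       eval z (f 1) * eval (mix z) (pderiv (Sum.inl 1) P)).re = 0)
    -- `Y' = f₁' ∂/∂z₁ + f₂' ∂/∂z₂` is a generalized rotation of `M_P`:
    (f' : Fin 2 → P2) (hf' : f' ≠ 0) (δ' : ℚ) (hδ' : 0 < δ')
    (hfhom' : ∀ j, IsWeightedHomogeneous μ (f' j) (μ j + δ'))
    (htan' : ∀ z : Fin 2 → ℂ,
      (eval z (f' 0) * eval (mix z) (pderiv (Sum.inl 0) P) +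
       eval z (f' 1) * eval (mix z) (pderiv (Sum.inl 1) P)).re = 0) :
    -- then `Y` and `Y'` are linearly dependent over `ℝ`:
    ∃ a b : ℝ, ¬(a = 0 ∧ b = 0) ∧
      ∀ j, C (a : ℂ) * f j + C (b : ℂ) * f' j = 0 := by
  have hP := conjSwap_eq_self hreal
  have hY := act_add_conjSwap htan
  have hY' := act_add_conjSwap htan'
  have hY0 : act f P ≠ 0 := fun h => hf (hnd f h)
  have hdet : f 0 * f' 1 = f 1 * f' 0 := by
    have hP0 : P.support.Nonempty := by
      rw [Finset.nonempty_iff_ne_empty, Ne, support_eq_empty]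
      rintro rfl
      exact hY0 (by simp [act])
    obtain ⟨m, hm, hmax⟩ := P.support.exists_max_image
      (Finsupp.weight (Sum.elim μ (0 : Fin 2 → ℚ))) hP0
    refine mul_comm_of_act_eq_zero (exists_pderiv_inl_ne_zero (m := m) ?_ (hplh m hm).1)
      (act_top_component_eq_zero hδ hfhom hP hY hmax)
      (act_top_component_eq_zero hδ' hfhom' hP hY' hmax)
    classical
    rw [mem_support_iff, coeff_weightedHomogeneousComponent, if_pos rfl]
    exact mem_support_iff.1 hm
  have hcross (i j : Fin 2) : f i * f' j = f j * f' i := by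
    fin_cases i <;> fin_cases j <;> simp only [Fin.zero_eta, Fin.mk_one]
    exacts [hdet, hdet.symm]
  obtain ⟨j, hj⟩ := Function.ne_iff.1 hf
  have hprop : rename Sum.inl (f j) * act f' P = rename Sum.inl (f' j) * act f P := by
    have h (i : Fin 2) := congrArg (rename (Sum.inl : Fin 2 → Fin 2 ⊕ Fin 2)) (hcross j i)
    simp only [map_mul] at h
    simp only [act]
    linear_combination pderiv (Sum.inl 0) P * h 0 + pderiv (Sum.inl 1) P * h 1
  have hprop' := congrArg conjSwap hprop
  rw [map_mul, map_mul, ← neg_eq_of_add_eq_zero_right hY,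
    ← neg_eq_of_add_eq_zero_right hY'] at hprop'
  obtain ⟨c, hc⟩ := exists_real_eq_C_mul (p := f j) (q := f' j) hj <| mul_right_cancel₀ hY0 <| by
    linear_combination conjSwap (rename Sum.inl (f j)) * hprop
      + rename Sum.inl (f j) * hprop'
  refine ⟨c, -1, by simp, fun i => mul_left_cancel₀ hj ?_⟩
  have hi := hcross j i
  rw [hc] at hi
  simp only [ofReal_neg, ofReal_one, map_neg, map_one]
  linear_combination -hi
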